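/- Let A ⊆ ℕ^n be a finite set. Every non-monomial extreme ray of the SONC cone C(A) is exposed; that is, if r = ℝ₊·f is an extreme ray of C(A) where f = Σ_{α∈S} c_α x^α ± Θ_f x^β is a nonnegative circuit polynomial on a reduced circuit (S, β) on A with |S| > 1 and all c_α > 0, then there exists a linear functional l on the space of polynomials supported on A with l(f) = 0 and l(g) > 0 for all g ∈ C(A) \ r. -/

import Mathlib

open MvPolynomial Finset

/-- A lattice exponent is even if every entry is even. -/
def IsEvenPt {n : ℕ} (α : Fin n →₀ ℕ) : Prop := ∀ i, Even (α i)

/-- The embedding of a lattice exponent into `ℝⁿ`. -/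
def toR {n : ℕ} (α : Fin n →₀ ℕ) : Fin n → ℝ := fun i => (α i : ℝ)

/-- `(S, β)` is a (simplicial) circuit on the ground set `A`:
`S ⊆ A ∩ (2ℕ)ⁿ` is affinely independent and `β ∈ A` lies in the relative
interior of `conv S`. -/
structure IsCircuitOn {n : ℕ} (A : Finset (Fin n →₀ ℕ)) (S : Finset (Fin n →₀ ℕ))
    (β : Fin n →₀ ℕ) : Prop where
  subset : S ⊆ A
  even_mem : ∀ α ∈ S, IsEvenPt α
  beta_mem : β ∈ A
  indep : AffineIndependent ℝ (fun α : S => toR (α : Fin n →₀ ℕ))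
  relint : toR β ∈ intrinsicInterior ℝ (convexHull ℝ (toR '' (S : Set (Fin n →₀ ℕ))))

/-- `lam` gives the barycentric coordinates of `β` with respect to `S`. -/
def IsBarycentric {n : ℕ} (S : Finset (Fin n →₀ ℕ)) (β : Fin n →₀ ℕ)
    (lam : (Fin n →₀ ℕ) → ℝ) : Prop :=
  (∀ α ∈ S, 0 < lam α) ∧ ∑ α ∈ S, lam α = 1 ∧
    ∀ i, (β i : ℝ) = ∑ α ∈ S, lam α * (α i : ℝ)

/-- The circuit number `Θ = ∏_{α ∈ S} (c_α / λ_α) ^ (λ_α)`. -/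
noncomputable def circuitNumber {n : ℕ} (S : Finset (Fin n →₀ ℕ))
    (c lam : (Fin n →₀ ℕ) → ℝ) : ℝ :=
  ∏ α ∈ S, (c α / lam α) ^ (lam α)

/-- The circuit polynomial `∑_{α ∈ S} c_α x^α + d x^β`. -/
noncomputable def circuitPoly {n : ℕ} (S : Finset (Fin n →₀ ℕ)) (β : Fin n →₀ ℕ)
    (c : (Fin n →₀ ℕ) → ℝ) (d : ℝ) : MvPolynomial (Fin n) ℝ :=
  (∑ α ∈ S, monomial α (c α)) + monomial β d

/-- Generators of the SONC cone on `A`: nonnegative circuit polynomials on circuits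
on `A`, together with monomial squares `x^α`, `α ∈ A ∩ (2ℕ)ⁿ`. -/
def SONCGen {n : ℕ} (A : Finset (Fin n →₀ ℕ)) : Set (MvPolynomial (Fin n) ℝ) :=
  {f | (∃ S β c d, IsCircuitOn A S β ∧ (∀ α ∈ S, 0 < c α) ∧
          f = circuitPoly S β c d ∧ ∀ x : Fin n → ℝ, 0 ≤ eval x f) ∨
       (∃ α ∈ A, IsEvenPt α ∧ f = monomial α 1)}

/-- The SONC cone on `A`: all finite nonnegative combinations of the generators. -/
def SONCCone {n : ℕ} (A : Finset (Fin n →₀ ℕ)) : Set (MvPolynomial (Fin n) ℝ) :=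
  {f | ∃ (k : ℕ) (g : Fin k → MvPolynomial (Fin n) ℝ) (μ : Fin k → ℝ),
        (∀ i, g i ∈ SONCGen A ∧ 0 ≤ μ i) ∧ f = ∑ i, μ i • g i}

/-- The ray `ℝ₊ · f`. -/
def raySet {n : ℕ} (f : MvPolynomial (Fin n) ℝ) : Set (MvPolynomial (Fin n) ℝ) :=
  {p | ∃ t : ℝ, 0 ≤ t ∧ p = t • f}

/-- `ℝ₊ · f` is an extreme ray of the convex cone `K`. -/
def IsExtremeRay {n : ℕ} (K : Set (MvPolynomial (Fin n) ℝ))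
    (f : MvPolynomial (Fin n) ℝ) : Prop :=
  f ≠ 0 ∧ f ∈ K ∧ ∀ g h, g ∈ K → h ∈ K → f = g + h → g ∈ raySet f ∧ h ∈ raySet f

/-- The ray `ℝ₊ · f` is an exposed face of `K`: some linear functional vanishes on
the ray and is strictly positive on the rest of `K`. -/
def IsExposedRay {n : ℕ} (K : Set (MvPolynomial (Fin n) ℝ))
    (f : MvPolynomial (Fin n) ℝ) : Prop :=
  ∃ l : MvPolynomial (Fin n) ℝ →ₗ[ℝ] ℝ,
    (∀ p ∈ raySet f, l p = 0) ∧ ∀ g ∈ K \ raySet f, 0 < l g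

/-- `(S, β)` is a reduced circuit on `A`: the only even points of `A` in `conv S`
are those of `S ∪ {β}`. -/
def IsReducedCircuitOn {n : ℕ} (A : Finset (Fin n →₀ ℕ)) (S : Finset (Fin n →₀ ℕ))
    (β : Fin n →₀ ℕ) : Prop :=
  IsCircuitOn A S β ∧
    {γ : Fin n →₀ ℕ | γ ∈ A ∧ IsEvenPt γ ∧
        toR γ ∈ convexHull ℝ (toR '' (S : Set (Fin n →₀ ℕ)))} =
      {γ : Fin n →₀ ℕ | (γ ∈ S ∨ γ = β) ∧ IsEvenPt γ}

theorem toR_injective {n : ℕ} : Function.Injective (toR : (Fin n →₀ ℕ) → Fin n → ℝ) := by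
  intro α γ h
  ext i
  have := congrFun h i
  simp only [toR] at this
  exact_mod_cast this

section Circuit

variable {n : ℕ} {A S T : Finset (Fin n →₀ ℕ)} {β : Fin n →₀ ℕ} {lam lam' : (Fin n →₀ ℕ) → ℝ}

theorem IsCircuitOn.eq_zero_of_sum_eq_zero (h : IsCircuitOn A S β) {u : (Fin n →₀ ℕ) → ℝ}
    (h₀ : ∑ α ∈ S, u α = 0) (h₁ : ∀ i, ∑ α ∈ S, u α * (α i : ℝ) = 0) : ∀ α ∈ S, u α = 0 := by
  have key := affineIndependent_iff.1 h.indep Finset.univ (fun α : S => u α)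
    (by rw [← h₀]; exact Finset.sum_coe_sort S u)
    (by
      ext i
      have := Finset.sum_coe_sort S (fun α => u α * (α i : ℝ))
      simpa [toR, h₁ i] using this)
  exact fun α hα => key ⟨α, hα⟩ (Finset.mem_univ _)

theorem IsBarycentric.toR_eq (h : IsBarycentric S β lam) : toR β = ∑ α ∈ S, lam α • toR α := by
  ext i
  simpa [toR] using h.2.2 i

/-- Barycentric coordinates with respect to a subset of an affinely independent set, all positive,
determine the subset and the coordinates. -/
theorem IsBarycentric.unique (hS : IsCircuitOn A S β) (h : IsBarycentric S β lam)
    (hTS : T ⊆ S) (h' : IsBarycentric T β lam') : T = S ∧ ∀ α ∈ S, lam' α = lam α := by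
  classical
  have key := hS.eq_zero_of_sum_eq_zero (u := fun α => lam α - if α ∈ T then lam' α else 0)
    (by
      rw [Finset.sum_sub_distrib, h.2.1, Finset.sum_ite_mem, Finset.inter_eq_right.2 hTS, h'.2.1,
        sub_self])
    (by
      intro i
      simp only [sub_mul, ite_mul, zero_mul]
      rw [Finset.sum_sub_distrib, ← h.2.2 i, Finset.sum_ite_mem, Finset.inter_eq_right.2 hTS,
        ← h'.2.2 i, sub_self])
  have hST : S ⊆ T := by
    intro α hα
    by_contra hn
    have := key α hα
    have := h.1 α hα
    simp_all
  refine ⟨hTS.antisymm hST, fun α hα => ?_⟩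
  have := key α hα
  simp only [hST hα, if_true] at this
  linarith

theorem IsBarycentric.eq_singleton_of_mem (hS : IsCircuitOn A S β) (h : IsBarycentric S β lam)
    (hβ : β ∈ S) : S = {β} := by
  have h' : IsBarycentric {β} β (fun _ => 1) := by simp [IsBarycentric]
  exact (h.unique hS (Finset.singleton_subset_iff.2 hβ) h').1.symm

theorem IsBarycentric.eq_of_singleton {γ : Fin n →₀ ℕ} (h : IsBarycentric {γ} β lam) : β = γ := by
  have h1 : lam γ = 1 := by simpa using h.2.1
  ext i
  have := h.2.2 i
  simp only [Finset.sum_singleton, h1, one_mul] at this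
  exact_mod_cast this

theorem IsCircuitOn.exists_barycentric (h : IsCircuitOn A S β) :
    ∃ lam, IsBarycentric S β lam := by
  classical
  set C := convexHull ℝ (toR '' (S : Set (Fin n →₀ ℕ))) with hC
  have hmem : ∀ x ∈ C, ∃ w : (Fin n →₀ ℕ) → ℝ, (∀ α ∈ S, 0 ≤ w α) ∧ ∑ α ∈ S, w α = 1 ∧
      ∑ α ∈ S, w α • toR α = x := by
    intro x hx
    rw [hC, ← Finset.coe_image, Finset.mem_convexHull'] at hx
    obtain ⟨w, h0, h1, h2⟩ := hx
    rw [Finset.sum_image toR_injective.injOn] at h1 h2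
    exact ⟨fun α => w (toR α), fun α hα => h0 _ (Finset.mem_image_of_mem _ hα), h1, h2⟩
  obtain ⟨y, hy, hyβ⟩ := mem_intrinsicInterior.1 h.relint
  have hS : S.Nonempty := by
    have : C.Nonempty := ⟨_, intrinsicInterior_subset h.relint⟩
    simpa [hC] using this
  set N : ℝ := (S.card : ℝ) with hN
  have hN0 : 0 < N := by simpa [hN] using hS.card_pos
  set z : Fin n → ℝ := ∑ α ∈ S, N⁻¹ • toR α with hz
  have hzC : z ∈ C := by
    refine (convex_convexHull ℝ _).sum_mem (fun _ _ => by positivity) ?_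
      fun α hα => subset_convexHull ℝ _ ⟨α, hα, rfl⟩
    rw [Finset.sum_const, nsmul_eq_mul, ← hN, mul_inv_cancel₀ hN0.ne']
  let g : ℝ → affineSpan ℝ C := fun s => ⟨AffineMap.lineMap z (toR β) s,
    AffineMap.lineMap_mem s (subset_affineSpan ℝ C hzC) (by rw [← hyβ]; exact y.2)⟩
  have hg : Continuous g := Continuous.subtype_mk AffineMap.lineMap_continuous _
  have hg1 : g 1 = y := Subtype.ext (by simp [g, hyβ])
  have hnhds : ∀ᶠ s in nhds (1 : ℝ), g s ∈ interior ((↑) ⁻¹' C : Set (affineSpan ℝ C)) :=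
    hg.continuousAt.eventually_mem (by rw [hg1]; exact isOpen_interior.mem_nhds hy)
  obtain ⟨s, hs, hs1⟩ := ((hnhds.filter_mono nhdsWithin_le_nhds).and
    (self_mem_nhdsWithin : Set.Ioi (1 : ℝ) ∈ nhdsWithin 1 (Set.Ioi 1))).exists
  have hs1 : 1 < s := hs1
  obtain ⟨w, hw0, hw1, hw2⟩ := hmem (g s) (show g s ∈ ((↑) ⁻¹' C : Set (affineSpan ℝ C)) from interior_subset hs)
  have hs0 : 0 < s := by linarith
  have hpos : 0 < 1 - s⁻¹ := by
    have := inv_lt_one_of_one_lt₀ hs1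
    linarith
  refine ⟨fun α => s⁻¹ * w α + (1 - s⁻¹) * N⁻¹, fun α hα => ?_, ?_, fun i => ?_⟩
  · have := hw0 α hα
    positivity
  · rw [Finset.sum_add_distrib, ← Finset.mul_sum, hw1, Finset.sum_const, nsmul_eq_mul, ← hN]
    field_simp
    ring
  · have h3 := congrFun hw2 i
    have hzi : z i = ∑ α ∈ S, N⁻¹ * (α i : ℝ) := by simp [hz, toR]
    simp only [g, AffineMap.lineMap_apply_module', Finset.sum_apply, Pi.smul_apply, smul_eq_mul,
      Pi.add_apply, Pi.sub_apply, toR] at h3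
    simp only [add_mul, Finset.sum_add_distrib, mul_assoc, ← Finset.mul_sum] at *
    rw [h3, hzi]
    field_simp
    ring

/-- Prescribed values on the vertices of a circuit are interpolated by an affine function. -/
theorem IsCircuitOn.exists_affine (h : IsCircuitOn A S β) (v : (Fin n →₀ ℕ) → ℝ) :
    ∃ (w : Fin n → ℝ) (b : ℝ), ∀ α ∈ S, ∑ i, w i * (α i : ℝ) + b = v α := by
  classical
  let F : (S → ℝ) →ₗ[ℝ] (Option (Fin n) → ℝ) :=
    { toFun := fun u j => ∑ α : S, u α * j.elim (1 : ℝ) (fun i => ((α : Fin n →₀ ℕ) i : ℝ))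
      map_add' := fun u u' => by ext j; simp [add_mul, Finset.sum_add_distrib]
      map_smul' := fun r u => by ext j; simp [Finset.mul_sum, mul_assoc] }
  have hF : Function.Injective F := by
    refine (injective_iff_map_eq_zero F).2 fun u hu => ?_
    let u' : (Fin n →₀ ℕ) → ℝ := fun α => if hα : α ∈ S then u ⟨α, hα⟩ else 0
    have hu' : ∀ α : S, u' α = u α := fun α => by simp [u']
    have key := h.eq_zero_of_sum_eq_zero (u := u')
      (by
        rw [← Finset.sum_coe_sort]
        simpa [hu', F] using congrFun hu none)
      (fun i => by
        rw [← Finset.sum_coe_sort]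
        simpa [hu', F] using congrFun hu (some i))
    ext α
    rw [← hu' α]
    exact key α α.2
  obtain ⟨ψ, hψ⟩ := LinearMap.dualMap_surjective_of_injective hF
    (∑ α : S, v α • LinearMap.proj α)
  refine ⟨fun i => ψ fun j => if some i = j then 1 else 0, ψ fun j => if none = j then 1 else 0,
    fun α hα => ?_⟩
  have h1 := LinearMap.congr_fun hψ (Pi.single ⟨α, hα⟩ 1)
  rw [LinearMap.dualMap_apply, LinearMap.pi_apply_eq_sum_univ ψ, Fintype.sum_option] at h1
  simp [F, Pi.single_apply] at h1
  simp only [mul_comm, add_comm] at h1 ⊢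
  exact h1

end Circuit

section TestPoints

variable {n : ℕ} {A S : Finset (Fin n →₀ ℕ)} {β : Fin n →₀ ℕ} {c lam : (Fin n →₀ ℕ) → ℝ} {d s : ℝ}

theorem IsBarycentric.affine_eq (h : IsBarycentric S β lam) (w : Fin n → ℝ) (b : ℝ) :
    ∑ i, w i * (β i : ℝ) + b = ∑ α ∈ S, lam α * (∑ i, w i * (α i : ℝ) + b) := by
  simp only [mul_add, Finset.sum_add_distrib, Finset.mul_sum]
  rw [← Finset.sum_mul, h.2.1, one_mul, Finset.sum_comm]
  congr 1
  refine Finset.sum_congr rfl fun i _ => ?_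
  rw [h.2.2 i, Finset.mul_sum]
  exact Finset.sum_congr rfl fun α _ => by ring

theorem eval_circuitPoly (x : Fin n → ℝ) : eval x (circuitPoly S β c d) =
    ∑ α ∈ S, c α * ∏ i, x i ^ α i + d * ∏ i, x i ^ β i := by
  simp [circuitPoly, eval_monomial, Finsupp.prod_fintype]

theorem prod_sign_mul_exp_pow (σ w : Fin n → ℝ) (γ : Fin n →₀ ℕ) :
    ∏ i, (σ i * Real.exp (w i)) ^ γ i =
      (∏ i, σ i ^ γ i) * Real.exp (∑ i, w i * (γ i : ℝ)) := by
  rw [Real.exp_sum, ← Finset.prod_mul_distrib]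
  refine Finset.prod_congr rfl fun i _ => ?_
  rw [mul_pow, ← Real.exp_nat_mul, mul_comm (γ i : ℝ)]

theorem exists_signs (hs : s = 1 ∨ (s = -1 ∧ ¬ IsEvenPt β)) :
    ∃ σ : Fin n → ℝ, ∏ i, σ i ^ β i = s ∧ ∀ α : Fin n →₀ ℕ, IsEvenPt α → ∏ i, σ i ^ α i = 1 := by
  classical
  rcases hs with rfl | ⟨rfl, hβ⟩
  · exact ⟨fun _ => 1, by simp, by simp⟩
  · obtain ⟨i, hi⟩ := not_forall.1 hβ
    have key : ∀ γ : Fin n →₀ ℕ,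
        ∏ j, (if j = i then (-1 : ℝ) else 1) ^ γ j = (-1) ^ γ i := by
      intro γ
      rw [Finset.prod_eq_single i] <;> simp +contextual
    refine ⟨fun j => if j = i then -1 else 1, ?_, fun α hα => ?_⟩
    · rw [key, (Nat.not_even_iff_odd.1 hi).neg_one_pow]
    · rw [key, (hα i).neg_one_pow]

/-- Evaluating a nonnegative circuit polynomial at points whose monomials take prescribed values
on the vertices of the circuit. -/
theorem IsCircuitOn.test_nonneg (h : IsCircuitOn A S β) (hlam : IsBarycentric S β lam)
    (hnn : ∀ x : Fin n → ℝ, 0 ≤ eval x (circuitPoly S β c d))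
    (hs : s = 1 ∨ (s = -1 ∧ ¬ IsEvenPt β)) (v : (Fin n →₀ ℕ) → ℝ) :
    0 ≤ ∑ α ∈ S, c α * Real.exp (v α) + d * (s * Real.exp (∑ α ∈ S, lam α * v α)) := by
  obtain ⟨w, b, hwb⟩ := h.exists_affine v
  obtain ⟨σ, hσβ, hσ⟩ := exists_signs hs
  have hβ : ∑ α ∈ S, lam α * v α = ∑ i, w i * (β i : ℝ) + b := by
    rw [hlam.affine_eq w b]
    exact Finset.sum_congr rfl fun α hα => by rw [hwb α hα]
  have h0 := mul_nonneg (hnn fun i => σ i * Real.exp (w i)) (Real.exp_pos b).le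
  rw [eval_circuitPoly, add_mul, Finset.sum_mul] at h0
  simp only [prod_sign_mul_exp_pow] at h0
  rw [hβ, Real.exp_add]
  refine h0.trans_eq ?_
  congr 1
  · refine Finset.sum_congr rfl fun α hα => ?_
    rw [← hwb α hα, Real.exp_add, hσ α (h.even_mem α hα)]
    ring
  · rw [hσβ]
    ring

theorem IsCircuitOn.test_pos (h : IsCircuitOn A S β) (hlam : IsBarycentric S β lam)
    (hc : ∀ α ∈ S, 0 < c α) (hnn : ∀ x : Fin n → ℝ, 0 ≤ eval x (circuitPoly S β c d))
    (hs : s = 1 ∨ (s = -1 ∧ ¬ IsEvenPt β)) (v : (Fin n →₀ ℕ) → ℝ) {e : ℝ} (he : 0 ≤ e)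
    (hlt : e < Real.exp (∑ α ∈ S, lam α * v α)) :
    0 < ∑ α ∈ S, c α * Real.exp (v α) + d * (s * e) := by
  have h0 := h.test_nonneg hlam hnn hs v
  set P := ∑ α ∈ S, c α * Real.exp (v α) with hP
  set E := Real.exp (∑ α ∈ S, lam α * v α)
  have hS : S.Nonempty := by
    by_contra hS
    have := hlam.2.1
    simp_all
  have hP0 : 0 < P := Finset.sum_pos (fun α hα => mul_pos (hc α hα) (Real.exp_pos _)) hS
  have hE : 0 < E := Real.exp_pos _
  by_contra hneg
  have h1 : E * (P + d * (s * e)) ≤ 0 := mul_nonpos_of_nonneg_of_nonpos hE.le (not_lt.1 hneg)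
  nlinarith [mul_nonneg he h0, mul_pos hP0 (sub_pos.2 hlt)]

/-- If the test value of a nonnegative circuit polynomial vanishes, the coefficients of the
vertices are determined by the inner one. -/
theorem IsCircuitOn.coeff_of_test_eq_zero (h : IsCircuitOn A S β) (hlam : IsBarycentric S β lam)
    (hnn : ∀ x : Fin n → ℝ, 0 ≤ eval x (circuitPoly S β c d))
    (hs : s = 1 ∨ (s = -1 ∧ ¬ IsEvenPt β)) (v : (Fin n →₀ ℕ) → ℝ)
    (h0 : ∑ α ∈ S, c α * Real.exp (v α) + d * (s * Real.exp (∑ α ∈ S, lam α * v α)) = 0) :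
    ∀ α ∈ S, c α * Real.exp (v α) =
      -(d * (s * Real.exp (∑ α ∈ S, lam α * v α))) * lam α := by
  classical
  intro α hα
  let G : ℝ → ℝ := fun t => ∑ γ ∈ S, c γ * Real.exp (v γ + t * if γ = α then 1 else 0) +
    d * (s * Real.exp (∑ γ ∈ S, lam γ * v γ + t * lam α))
  have hG : ∀ t, 0 ≤ G t := by
    intro t
    have := h.test_nonneg hlam hnn hs fun γ => v γ + t * if γ = α then 1 else 0
    convert this using 5
    simp [mul_add, Finset.sum_add_distrib, hα, mul_comm]
  have hG0 : G 0 = 0 := by simpa [G] using h0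
  have hderiv : HasDerivAt G (∑ γ ∈ S, c γ * (Real.exp (v γ) * if γ = α then 1 else 0) +
      d * (s * (Real.exp (∑ γ ∈ S, lam γ * v γ) * lam α))) 0 := by
    have hexp : ∀ a b : ℝ, HasDerivAt (fun t : ℝ => Real.exp (a + t * b)) (Real.exp a * b) 0 := by
      intro a b
      have := (((hasDerivAt_id (0 : ℝ)).mul_const b).const_add a).exp
      simpa using this
    exact (HasDerivAt.fun_sum fun γ _ => (hexp _ _).const_mul _).add
      (((hexp _ _).const_mul _).const_mul _)
  have hmin : IsLocalMin G 0 := Filter.Eventually.of_forall fun t => by rw [hG0]; exact hG t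
  have := hmin.hasDerivAt_eq_zero hderiv
  simp only [mul_ite, mul_one, mul_zero, Finset.sum_ite_eq', hα, if_true] at this
  linarith

end TestPoints

theorem Convex.convexOn_infDist {E : Type*} [SeminormedAddCommGroup E] [NormedSpace ℝ E]
    {C : Set E} (hC : Convex ℝ C) (hcomp : IsCompact C) (hne : C.Nonempty) :
    ConvexOn ℝ Set.univ fun x => Metric.infDist x C := by
  refine ⟨convex_univ, fun x _ y _ a b ha hb hab => ?_⟩
  obtain ⟨p, hp, hxp⟩ := hcomp.exists_infDist_eq_dist hne x
  obtain ⟨q, hq, hyq⟩ := hcomp.exists_infDist_eq_dist hne y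
  refine (Metric.infDist_le_dist_of_mem (hC hp hq ha hb hab)).trans ?_
  simp only [hxp, hyq, dist_eq_norm, smul_eq_mul]
  calc ‖a • x + b • y - (a • p + b • q)‖ = ‖a • (x - p) + b • (y - q)‖ := by
        congr 1
        module
    _ ≤ ‖a • (x - p)‖ + ‖b • (y - q)‖ := norm_add_le _ _
    _ = a * ‖x - p‖ + b * ‖y - q‖ := by
        rw [norm_smul, norm_smul, Real.norm_of_nonneg ha, Real.norm_of_nonneg hb]

section Height

variable {n : ℕ} {A S : Finset (Fin n →₀ ℕ)} {β : Fin n →₀ ℕ} {lam : (Fin n →₀ ℕ) → ℝ}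

theorem IsBarycentric.sum_sq_lt (h : IsBarycentric S β lam) (hS : 1 < S.card) :
    ∑ i, (β i : ℝ) ^ 2 < ∑ α ∈ S, lam α * ∑ i, (α i : ℝ) ^ 2 := by
  have key : ∑ α ∈ S, lam α * ∑ i, (α i : ℝ) ^ 2 =
      ∑ i, (β i : ℝ) ^ 2 + ∑ α ∈ S, lam α * ∑ i, ((α i : ℝ) - β i) ^ 2 := by
    simp only [Finset.mul_sum]
    rw [Finset.sum_comm, Finset.sum_comm (s := S), ← Finset.sum_add_distrib]
    refine Finset.sum_congr rfl fun i _ => ?_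
    have : ∀ α ∈ S, lam α * ((α i : ℝ) - β i) ^ 2 =
        lam α * (α i : ℝ) ^ 2 - 2 * (β i : ℝ) * (lam α * (α i : ℝ)) + lam α * (β i : ℝ) ^ 2 :=
      fun α _ => by ring
    rw [Finset.sum_congr rfl this, Finset.sum_add_distrib, Finset.sum_sub_distrib,
      ← Finset.mul_sum, ← Finset.sum_mul, ← h.2.2 i, h.2.1]
    ring
  obtain ⟨α, hα, hne⟩ := Finset.exists_mem_ne hS β
  obtain ⟨i, hi⟩ := DFunLike.ne_iff.1 hne
  rw [key, lt_add_iff_pos_right]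
  refine Finset.sum_pos' (fun γ hγ => mul_nonneg (h.1 γ hγ).le (by positivity))
    ⟨α, hα, mul_pos (h.1 α hα) (Finset.sum_pos' (fun _ _ => by positivity)
      ⟨i, Finset.mem_univ _, ?_⟩)⟩
  have : (α i : ℝ) - β i ≠ 0 := sub_ne_zero.2 (by exact_mod_cast hi)
  positivity

/-- A height function with prescribed values on the vertices of a reduced circuit, balanced on that
circuit and strictly convex along every other relevant circuit. -/
theorem IsReducedCircuitOn.exists_height (hred : IsReducedCircuitOn A S β) (hcard : 1 < S.card)
    (hlam : IsBarycentric S β lam) (v : (Fin n →₀ ℕ) → ℝ) :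
    ∃ φ : (Fin n →₀ ℕ) → ℝ, (∀ α ∈ S, φ α = v α) ∧ φ β = ∑ α ∈ S, lam α * v α ∧
      ∀ S' β' lam', IsCircuitOn A S' β' → IsBarycentric S' β' lam' → 1 < S'.card →
        (S' ≠ S ∨ β' ≠ β) → φ β' < ∑ α ∈ S', lam' α * φ α := by
  classical
  obtain ⟨hcirc, hset⟩ := hred
  set C := convexHull ℝ (toR '' (S : Set (Fin n →₀ ℕ))) with hC
  have hfin : (toR '' (S : Set (Fin n →₀ ℕ))).Finite := S.finite_toSet.image _
  have hCne : C.Nonempty := ⟨_, intrinsicInterior_subset hcirc.relint⟩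
  have hβS : ∀ {T : Finset (Fin n →₀ ℕ)} {μ}, IsCircuitOn A T β → IsBarycentric T β μ →
      1 < T.card → β ∉ T := by
    intro T μ hT hμ hT1 hmem
    rw [hμ.eq_singleton_of_mem hT hmem] at hT1
    simp at hT1
  let D : (Fin n →₀ ℕ) → ℝ := fun γ => Metric.infDist (toR γ) C
  have hDS : ∀ α ∈ S, D α = 0 := fun α hα =>
    Metric.infDist_zero_of_mem (subset_convexHull ℝ _ ⟨α, hα, rfl⟩)
  have hD0 : ∀ γ, 0 ≤ D γ := fun γ => Metric.infDist_nonneg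
  have hDpos : ∀ γ ∈ A, IsEvenPt γ → γ ∉ S → γ ≠ β → 0 < D γ := by
    intro γ hγA hγ hγS hγβ
    refine ((hfin.isClosed_convexHull ℝ).notMem_iff_infDist_pos hCne).1 fun hmem => ?_
    have := hset.subset ⟨hγA, hγ, hmem⟩
    exact this.1.elim hγS hγβ
  have hDconv : ∀ {T : Finset (Fin n →₀ ℕ)} {γ μ}, IsBarycentric T γ μ →
      D γ ≤ ∑ α ∈ T, μ α * D α := by
    intro T γ μ h
    have := ((convex_convexHull ℝ _).convexOn_infDist (hfin.isCompact_convexHull ℝ) hCne).map_sum_le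
      (fun α hα => (h.1 α hα).le) h.2.1 (p := toR) fun _ _ => Set.mem_univ _
    rwa [← h.toR_eq] at this
  let Q : (Fin n →₀ ℕ) → ℝ := fun γ => ∑ i, (γ i : ℝ) ^ 2
  obtain ⟨w, b, hwb⟩ := hcirc.exists_affine fun α => v α - Q α
  let a : (Fin n →₀ ℕ) → ℝ := fun γ => ∑ i, w i * (γ i : ℝ) + b
  set V := ∑ α ∈ S, lam α * v α with hV
  have hev : ∀ᶠ M : ℝ in Filter.atTop, ∀ T ∈ A.powerset, ∀ μ, IsCircuitOn A T β →
      IsBarycentric T β μ → 0 < ∑ α ∈ T, μ α * D α →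
        V < ∑ α ∈ T, μ α * (a α + Q α) + M * ∑ α ∈ T, μ α * D α := by
    refine (Filter.eventually_all_finset _).2 fun T _ => ?_
    by_cases hT : ∃ μ, IsCircuitOn A T β ∧ IsBarycentric T β μ ∧ 0 < ∑ α ∈ T, μ α * D α
    · obtain ⟨μ, hT1, hT2, hT3⟩ := hT
      have := (Filter.tendsto_atTop_add_const_left Filter.atTop (∑ α ∈ T, μ α * (a α + Q α))
        (Filter.tendsto_id.atTop_mul_const hT3)).eventually_gt_atTop V
      filter_upwards [this] with M hM μ' _ hμ' _
      have huniq := (hT2.unique hT1 subset_rfl hμ').2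
      have hsum : ∀ u : (Fin n →₀ ℕ) → ℝ, ∑ α ∈ T, μ' α * u α = ∑ α ∈ T, μ α * u α :=
        fun u => Finset.sum_congr rfl fun α hα => by rw [huniq α hα]
      rw [hsum D, hsum fun α => a α + Q α]
      exact hM
    · exact Filter.Eventually.of_forall fun M μ h1 h2 h3 => (hT ⟨μ, h1, h2, h3⟩).elim
  obtain ⟨M, hM, hM0⟩ := (hev.and (Filter.eventually_ge_atTop 0)).exists
  let F : (Fin n →₀ ℕ) → ℝ := fun γ => a γ + Q γ + M * D γ
  have hFS : ∀ α ∈ S, F α = v α := by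
    intro α hα
    have h1 : a α = v α - Q α := hwb α hα
    simp only [F, hDS α hα, h1]
    ring
  have hFsum : ∀ (T : Finset (Fin n →₀ ℕ)) (μ : (Fin n →₀ ℕ) → ℝ), ∑ α ∈ T, μ α * F α =
      ∑ α ∈ T, μ α * (a α + Q α) + M * ∑ α ∈ T, μ α * D α := by
    intro T μ
    rw [Finset.mul_sum, ← Finset.sum_add_distrib]
    exact Finset.sum_congr rfl fun α _ => by simp only [F]; ring
  have hFconv : ∀ {T : Finset (Fin n →₀ ℕ)} {γ μ}, IsBarycentric T γ μ → 1 < T.card →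
      F γ < ∑ α ∈ T, μ α * F α := by
    intro T γ μ h hT
    have h1 : a γ = _ := h.affine_eq w b
    have h2 : Q γ < _ := h.sum_sq_lt hT
    have h3 := mul_le_mul_of_nonneg_left (hDconv h) hM0
    rw [hFsum]
    simp only [mul_add (_ : ℝ) (a _), Finset.sum_add_distrib]
    simp only [F, a, Q] at *
    linarith
  have hFβ : F β < V := by
    have := hFconv hlam hcard
    rwa [Finset.sum_congr rfl fun α hα => by rw [hFS α hα]] at this
  let φ : (Fin n →₀ ℕ) → ℝ := fun γ => if γ = β then V else F γ
  have hφ : ∀ γ, γ ≠ β → φ γ = F γ := fun γ hγ => if_neg hγ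
  have hFφ : ∀ γ, F γ ≤ φ γ := by
    intro γ
    by_cases hγ : γ = β
    · subst hγ
      simpa [φ] using hFβ.le
    · rw [hφ γ hγ]
  refine ⟨φ, fun α hα => ?_, if_pos rfl, fun T γ μ hT hμ hT1 hne => ?_⟩
  · rw [hφ α fun h => hβS hcirc hlam hcard (h ▸ hα), hFS α hα]
  by_cases hγβ : γ = β
  · subst hγβ
    have hγT := hβS hT hμ hT1
    have hTS : ¬ T ⊆ S := fun hTS =>
      (hne.resolve_right fun h => h rfl) (hlam.unique hcirc hTS hμ).1
    obtain ⟨α, hαT, hαS⟩ := Finset.not_subset.1 hTS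
    have hpos : 0 < ∑ α ∈ T, μ α * D α :=
      Finset.sum_pos' (fun δ hδ => mul_nonneg (hμ.1 δ hδ).le (hD0 δ))
        ⟨α, hαT, mul_pos (hμ.1 α hαT) (hDpos α (hT.subset hαT) (hT.even_mem α hαT) hαS
          fun h => hγT (h ▸ hαT))⟩
    have := hM T (Finset.mem_powerset.2 hT.subset) μ hT hμ hpos
    rw [← hFsum] at this
    refine (if_pos rfl : φ γ = V).trans_lt (this.trans_le ?_)
    exact Finset.sum_le_sum fun α hα => mul_le_mul_of_nonneg_left (hFφ α) (hμ.1 α hα).le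
  · rw [hφ γ hγβ]
    refine (hFconv hμ hT1).trans_le ?_
    exact Finset.sum_le_sum fun α hα => mul_le_mul_of_nonneg_left (hFφ α) (hμ.1 α hα).le

end Height

section Cone

variable {n : ℕ} {A S : Finset (Fin n →₀ ℕ)} {β : Fin n →₀ ℕ} {c lam : (Fin n →₀ ℕ) → ℝ} {d : ℝ}
  {f : MvPolynomial (Fin n) ℝ}

theorem IsExposedRay.of_generators (l : MvPolynomial (Fin n) ℝ →ₗ[ℝ] ℝ) (hf : l f = 0)
    (h : ∀ g ∈ SONCGen A, 0 ≤ l g ∧ (l g = 0 → g ∈ raySet f)) :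
    IsExposedRay (SONCCone A) f := by
  refine ⟨l, ?_, ?_⟩
  · rintro p ⟨t, -, rfl⟩
    rw [map_smul, hf, smul_zero]
  · rintro g ⟨⟨k, p, μ, hp, rfl⟩, hg⟩
    have hterm : ∀ i ∈ Finset.univ, 0 ≤ μ i * l (p i) := fun i _ =>
      mul_nonneg (hp i).2 (h _ (hp i).1).1
    have hl : l (∑ i, μ i • p i) = ∑ i, μ i * l (p i) := by simp
    rw [hl]
    refine (Finset.sum_nonneg hterm).lt_of_ne' fun h0 => hg ?_
    rw [Finset.sum_eq_zero_iff_of_nonneg hterm] at h0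
    have hray : ∀ i, ∃ t : ℝ, 0 ≤ t ∧ μ i • p i = t • f := by
      intro i
      rcases mul_eq_zero.1 (h0 i (Finset.mem_univ i)) with h1 | h1
      · exact ⟨0, le_rfl, by rw [h1, zero_smul, zero_smul]⟩
      · obtain ⟨t, ht, hpt⟩ := (h _ (hp i).1).2 h1
        exact ⟨μ i * t, mul_nonneg (hp i).2 ht, by rw [hpt, mul_smul]⟩
    choose t ht hpt using hray
    exact ⟨∑ i, t i, Finset.sum_nonneg fun i _ => ht i, by simp_rw [hpt, Finset.sum_smul]⟩

theorem sum_monomial_mem_SONCCone {T : Finset (Fin n →₀ ℕ)} (hTA : T ⊆ A)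
    (hT : ∀ α ∈ T, IsEvenPt α) {u : (Fin n →₀ ℕ) → ℝ} (hu : ∀ α ∈ T, 0 ≤ u α) :
    ∑ α ∈ T, monomial α (u α) ∈ SONCCone A := by
  let e := T.equivFin.symm
  refine ⟨T.card, fun i => monomial (e i : Fin n →₀ ℕ) 1, fun i => u (e i),
    fun i => ⟨Or.inr ⟨_, hTA (e i).2, hT _ (e i).2, rfl⟩, hu _ (e i).2⟩, ?_⟩
  rw [e.sum_comp (fun α : T => u α • (monomial (α : Fin n →₀ ℕ) (1 : ℝ))),
    Finset.sum_coe_sort T fun α => u α • (monomial α (1 : ℝ))]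
  simp [smul_monomial]

theorem circuitNumber_eq_exp (hc : ∀ α ∈ S, 0 < c α) (hlam : IsBarycentric S β lam) :
    circuitNumber S c lam = (Real.exp (∑ α ∈ S, lam α * Real.log (lam α / c α)))⁻¹ := by
  rw [circuitNumber, ← Real.exp_neg, ← Finset.sum_neg_distrib, Real.exp_sum]
  refine Finset.prod_congr rfl fun α hα => ?_
  rw [Real.rpow_def_of_pos (div_pos (hc α hα) (hlam.1 α hα)), ← inv_div, Real.log_inv]
  congr 1
  ring

/-- A circuit polynomial with even inner exponent and positive inner coefficient is a sum of
monomial squares, hence does not span an extreme ray. -/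
theorem IsCircuitOn.not_isExtremeRay (h : IsCircuitOn A S β) (hβS : β ∉ S) (hS : S.Nonempty)
    (hβ : IsEvenPt β) (hc : ∀ α ∈ S, 0 < c α) (hd : 0 < d) :
    ¬ IsExtremeRay (SONCCone A) (circuitPoly S β c d) := by
  classical
  rintro ⟨-, -, hext⟩
  have h1 := sum_monomial_mem_SONCCone h.subset h.even_mem fun α hα => (hc α hα).le
  have h2 : monomial β d ∈ SONCCone A := by
    simpa using sum_monomial_mem_SONCCone (T := {β}) (u := fun _ => d)
      (Finset.singleton_subset_iff.2 h.beta_mem) (by simpa using hβ) (by simp [hd.le])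
  obtain ⟨⟨t, -, ht⟩, -⟩ := hext _ _ h1 h2 rfl
  have hcoeffβ := congrArg (coeff β) ht
  obtain ⟨α, hα⟩ := hS
  have hcoeffα := congrArg (coeff α) ht
  have hβα : β ≠ α := fun h => hβS (h ▸ hα)
  simp [circuitPoly, coeff_sum, coeff_monomial, hβS, hd.ne'] at hcoeffβ
  simp [hcoeffβ, coeff_sum, coeff_monomial, hα] at hcoeffα
  exact (hc α hα).ne' hcoeffα

end Cone

/-- **Every non-monomial extreme ray of the SONC cone is exposed.** If
`f = ∑ c_α x^α ± Θ_f x^β` is a nonnegative circuit polynomial on a reduced circuit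
`(S, β)` on `A` with `|S| > 1` generating an extreme ray, then that ray is exposed. -/
theorem nonmonomial_ray_exposed {n : ℕ} (A : Finset (Fin n →₀ ℕ))
    (S : Finset (Fin n →₀ ℕ)) (β : Fin n →₀ ℕ) (c lam : (Fin n →₀ ℕ) → ℝ) (ε : ℝ)
    (hred : IsReducedCircuitOn A S β) (hcard : 1 < S.card)
    (hc : ∀ α ∈ S, 0 < c α) (hlam : IsBarycentric S β lam)
    (hε : ε = 1 ∨ ε = -1) (f : MvPolynomial (Fin n) ℝ)
    (hfdef : f = circuitPoly S β c (ε * circuitNumber S c lam))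
    (hnn : ∀ x : Fin n → ℝ, 0 ≤ eval x f)
    (hext : IsExtremeRay (SONCCone A) f) :
    IsExposedRay (SONCCone A) f := by
  classical
  obtain ⟨hcirc, -⟩ := id hred
  have hβS : β ∉ S := fun h => by
    rw [hlam.eq_singleton_of_mem hcirc h] at hcard
    simp at hcard
  have hS : S.Nonempty := Finset.card_pos.1 (by omega)
  obtain ⟨φ, hφS, hφβ, hφ⟩ := hred.exists_height hcard hlam fun α => Real.log (lam α / c α)
  have hΘ := circuitNumber_eq_exp hc hlam
  rw [← hφβ] at hΘ
  have hφβ' : φ β = ∑ α ∈ S, lam α * φ α := by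
    rw [hφβ]
    exact Finset.sum_congr rfl fun α hα => by rw [hφS α hα]
  have hsign : -ε = 1 ∨ (-ε = -1 ∧ ¬ IsEvenPt β) := by
    rcases hε with rfl | rfl
    · refine Or.inr ⟨rfl, fun hβ => ?_⟩
      refine hcirc.not_isExtremeRay hβS hS hβ hc (d := 1 * circuitNumber S c lam) ?_ (hfdef ▸ hext)
      rw [hΘ]
      positivity
    · exact Or.inl (neg_neg 1)
  let ℓ : (Fin n →₀ ℕ) → ℝ := fun γ =>
    if γ = β then -ε * Real.exp (φ β) else if IsEvenPt γ then Real.exp (φ γ) else 0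
  have hℓβ : ℓ β = -ε * Real.exp (φ β) := if_pos rfl
  have hℓeven : ∀ γ, IsEvenPt γ → ℓ γ = Real.exp (φ γ) := by
    intro γ hγ
    by_cases h : γ = β
    · subst h
      rw [hℓβ, hsign.resolve_right fun h => h.2 hγ, one_mul]
    · simp [ℓ, h, hγ]
  have hℓodd : ∀ γ, γ ≠ β → ¬ IsEvenPt γ → ℓ γ = 0 := fun γ h hγ => by simp [ℓ, h, hγ]
  let l : MvPolynomial (Fin n) ℝ →ₗ[ℝ] ℝ := (basisMonomials (Fin n) ℝ).constr ℝ ℓ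
  have hl : ∀ γ (r : ℝ), l (monomial γ r) = r * ℓ γ := by
    intro γ r
    have h1 : monomial γ r = r • basisMonomials (Fin n) ℝ γ := by simp [smul_monomial]
    rw [h1, map_smul, Module.Basis.constr_basis, smul_eq_mul]
  have hlcirc : ∀ {T : Finset (Fin n →₀ ℕ)} {γ : Fin n →₀ ℕ} {c' : (Fin n →₀ ℕ) → ℝ} {d' : ℝ},
      IsCircuitOn A T γ →
      l (circuitPoly T γ c' d') = ∑ α ∈ T, c' α * Real.exp (φ α) + d' * ℓ γ := by
    intro T γ c' d' hT
    simp only [circuitPoly, map_add, map_sum, hl]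
    congr 1
    exact Finset.sum_congr rfl fun α hα => by rw [hℓeven α (hT.even_mem α hα)]
  have hexpS : ∀ α ∈ S, Real.exp (φ α) = lam α / c α := fun α hα => by
    rw [hφS α hα, Real.exp_log (div_pos (hlam.1 α hα) (hc α hα))]
  have hεε : ε * ε = 1 := by rcases hε with rfl | rfl <;> norm_num
  refine IsExposedRay.of_generators l ?_ ?_
  · rw [hfdef, hlcirc hcirc, hℓβ, hΘ]
    have h1 : ∑ α ∈ S, c α * Real.exp (φ α) = 1 := by
      rw [← hlam.2.1]
      refine Finset.sum_congr rfl fun α hα => ?_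
      rw [hexpS α hα, mul_div_cancel₀ _ (hc α hα).ne']
    have h2 : ε * (Real.exp (φ β))⁻¹ * (-ε * Real.exp (φ β)) = -(ε * ε) := by
      field_simp
    rw [h1, h2, hεε, add_neg_cancel]
  rintro g (⟨T, γ, c', d', hT, hc', rfl, hg⟩ | ⟨α, -, hα, rfl⟩)
  · obtain ⟨lam', hlam'⟩ := hT.exists_barycentric
    have hTne : T.Nonempty := by
      by_contra hne
      have := hlam'.2.1
      simp_all
    rcases Nat.lt_or_eq_of_le hTne.card_pos with hT1 | hT1
    · rw [hlcirc hT]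
      have hstrict : ∀ s e : ℝ, (s = 1 ∨ (s = -1 ∧ ¬ IsEvenPt γ)) → 0 ≤ e →
          e < Real.exp (∑ α ∈ T, lam' α * φ α) → ℓ γ = s * e →
          0 ≤ ∑ α ∈ T, c' α * Real.exp (φ α) + d' * ℓ γ ∧
            (∑ α ∈ T, c' α * Real.exp (φ α) + d' * ℓ γ = 0 →
              circuitPoly T γ c' d' ∈ raySet f) := by
        intro s e hs he hlt hℓ
        have hpos := hT.test_pos hlam' hc' hg hs φ he hlt
        rw [← hℓ] at hpos
        exact ⟨hpos.le, fun h => (hpos.ne' h).elim⟩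
      by_cases hγβ : γ = β
      · subst hγβ
        by_cases hTS : T = S
        · subst hTS
          rw [hℓβ, hφβ']
          refine ⟨hT.test_nonneg hlam hg hsign φ, fun h0 => ?_⟩
          have hcoeff := hT.coeff_of_test_eq_zero hlam hg hsign φ h0
          rw [← hφβ'] at hcoeff
          set t := d' * (ε * Real.exp (φ γ)) with ht
          have hct : ∀ α ∈ T, c' α = t * c α := by
            intro α hα
            have h1 := hcoeff α hα
            have h2 := hc α hα
            have h3 := hlam.1 α hα
            rw [hexpS α hα] at h1
            field_simp at h1
            rw [ht]
            linarith
          have ht0 : 0 ≤ t := by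
            obtain ⟨α, hα⟩ := hS
            have h1 := hc' α hα
            rw [hct α hα] at h1
            exact (pos_of_mul_pos_left h1 (hc α hα).le).le
          refine ⟨t, ht0, ?_⟩
          have hd : d' = t * (ε * circuitNumber T c lam) := by
            rw [hΘ, ht]
            have : d' * (ε * Real.exp (φ γ)) * (ε * (Real.exp (φ γ))⁻¹) = d' * (ε * ε) := by
              field_simp
            rw [this, hεε, mul_one]
          rw [hfdef, circuitPoly, circuitPoly, smul_add, Finset.smul_sum, smul_monomial,
            smul_eq_mul, ← hd]
          congr 1
          exact Finset.sum_congr rfl fun α hα => by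
            rw [hct α hα, smul_monomial, smul_eq_mul]
        · exact hstrict (-ε) _ hsign (Real.exp_pos _).le
            (Real.exp_lt_exp.2 (hφ T γ lam' hT hlam' hT1 (Or.inl hTS))) hℓβ
      · by_cases hγ : IsEvenPt γ
        · exact hstrict 1 _ (Or.inl rfl) (Real.exp_pos _).le
            (Real.exp_lt_exp.2 (hφ T γ lam' hT hlam' hT1 (Or.inr hγβ)))
            (by rw [hℓeven γ hγ, one_mul])
        · exact hstrict 1 0 (Or.inl rfl) le_rfl (Real.exp_pos _)
            (by rw [hℓodd γ hγβ hγ, mul_zero])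
    · obtain ⟨δ, rfl⟩ := Finset.card_eq_one.1 hT1.symm
      obtain rfl := hlam'.eq_of_singleton
      have hmon : circuitPoly {γ} γ c' d' = monomial γ (c' γ + d') := by
        simp [circuitPoly]
      have h0 : 0 ≤ c' γ + d' := by simpa [eval_circuitPoly] using hg fun _ => 1
      rw [hmon, hl, hℓeven γ (hT.even_mem γ (Finset.mem_singleton_self γ))]
      refine ⟨mul_nonneg h0 (Real.exp_pos _).le, fun h => ⟨0, le_rfl, ?_⟩⟩
      rw [(mul_eq_zero.1 h).resolve_right (Real.exp_pos _).ne', monomial_zero, zero_smul]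
  · rw [hl, hℓeven α hα, one_mul]
    exact ⟨(Real.exp_pos _).le, fun h => ((Real.exp_pos _).ne' h).elim⟩
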